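/- Let X ∈ ℝ^{n×p}, y ∈ ℝⁿ, λ > 0, and let q: ℝ^p → ℝ be convex and differentiable, with f(β) = (1/2)‖Xβ − y‖² + λ‖β‖₁ − q(β) bounded below on ℝ^p. Let (σ^{2,k})_{k≥0} be positive reals with inf_k σ^{2,k} > 0, and let (β^k)_{k≥0}, (δ^k)_{k≥0} in ℝ^p be such that for every k, β^{k+1} is a global minimizer of β ↦ J_k(β) + ⟨δ^k, β − β^k⟩, where J_k(β) = (1/2)‖Xβ − y‖² + λ‖β‖₁ − q(β^k) − ⟨∇q(β^k), β − β^k⟩ + (σ^{2,k}/2)‖β − β^k‖², and ‖δ^k‖ ≤ (σ^{2,k}/4)‖β^{k+1} − β^k‖. Then the sequence (f(β^k)) is non-increasing and convergent, and ‖β^{k+1} − β^k‖ → 0 as k → ∞. -/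

import Mathlib

open Filter Topology

/-- Euclidean norm on `Fin m → ℝ`. -/
noncomputable def euclNorm {m : ℕ} (x : Fin m → ℝ) : ℝ := Real.sqrt (∑ i, (x i) ^ 2)

/-- ℓ₁ norm on `Fin m → ℝ`. -/
noncomputable def l1Norm {m : ℕ} (x : Fin m → ℝ) : ℝ := ∑ i, |x i|

/-- Euclidean inner product on `Fin m → ℝ`. -/
noncomputable def dotp {m : ℕ} (x y : Fin m → ℝ) : ℝ := ∑ i, x i * y i

/-- The continuous linear functional `v ↦ ⟨g, v⟩` on `Fin m → ℝ`. -/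
noncomputable def dotCLM {m : ℕ} (g : Fin m → ℝ) : (Fin m → ℝ) →L[ℝ] ℝ :=
  ∑ i, g i • ContinuousLinearMap.proj i

/-- The objective `f(β) = (1/2)‖Xβ − y‖² + λ‖β‖₁ − q(β)`. -/
noncomputable def fObj {n p : ℕ} (X : Matrix (Fin n) (Fin p) ℝ) (y : Fin n → ℝ)
    (lam : ℝ) (q : (Fin p → ℝ) → ℝ) (β : Fin p → ℝ) : ℝ :=
  (1 / 2) * (euclNorm (X.mulVec β - y)) ^ 2 + lam * l1Norm β - q β

/-- The majorization `J_k(β)`. -/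
noncomputable def Jmaj {n p : ℕ} (X : Matrix (Fin n) (Fin p) ℝ) (y : Fin n → ℝ)
    (lam sigma : ℝ) (q : (Fin p → ℝ) → ℝ) (g : (Fin p → ℝ) → (Fin p → ℝ))
    (βk β : Fin p → ℝ) : ℝ :=
  (1 / 2) * (euclNorm (X.mulVec β - y)) ^ 2 + lam * l1Norm β - q βk
    - dotp (g βk) (β - βk) + (sigma / 2) * (euclNorm (β - βk)) ^ 2

/-- First-order characterization: a convex function lies above its tangent hyperplanes. -/
theorem ConvexOn.add_fderiv_sub_le {E : Type*} [NormedAddCommGroup E] [NormedSpace ℝ E]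
    {q : E → ℝ} {q' : E →L[ℝ] ℝ} {a : E} (hq : ConvexOn ℝ Set.univ q)
    (hq' : HasFDerivAt q q' a) (b : E) : q a + q' (b - a) ≤ q b := by
  have hline : ConvexOn ℝ Set.univ (q ∘ AffineMap.lineMap (k := ℝ) a b) := by
    simpa using hq.comp_affineMap (AffineMap.lineMap (k := ℝ) a b)
  have hderiv : HasDerivAt (q ∘ AffineMap.lineMap (k := ℝ) a b) (q' (b - a)) 0 := by
    refine HasFDerivAt.comp_hasDerivAt (0 : ℝ) ?_ AffineMap.hasDerivAt_lineMap
    simpa using hq'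
  have h := hline.le_slope_of_hasDerivAt (Set.mem_univ 0) (Set.mem_univ 1) zero_lt_one hderiv
  simp only [slope_def_field, Function.comp_apply, AffineMap.lineMap_apply_zero,
    AffineMap.lineMap_apply_one, sub_zero, div_one] at h
  linarith

theorem dotCLM_apply {m : ℕ} (g v : Fin m → ℝ) : dotCLM g v = dotp g v := by
  simp [dotCLM, dotp]

theorem euclNorm_nonneg {m : ℕ} (x : Fin m → ℝ) : 0 ≤ euclNorm x :=
  Real.sqrt_nonneg _

/-- Cauchy–Schwarz inequality, lower bound. -/
theorem neg_mul_euclNorm_le_dotp {m : ℕ} (x y : Fin m → ℝ) :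
    -(euclNorm x * euclNorm y) ≤ dotp x y := by
  have h := Real.sum_mul_le_sqrt_mul_sqrt Finset.univ (fun i => -x i) y
  simp only [neg_mul, Finset.sum_neg_distrib, neg_sq] at h
  unfold euclNorm dotp
  linarith

/-- Inexact minimization of the majorization decreases the objective by a multiple of the
squared step length. -/
theorem fObj_add_sq_le {n p : ℕ} {lam sigma : ℝ} {X : Matrix (Fin n) (Fin p) ℝ} {y : Fin n → ℝ}
    {q : (Fin p → ℝ) → ℝ} {g : (Fin p → ℝ) → (Fin p → ℝ)} {a b d : Fin p → ℝ}
    (hqconv : ConvexOn ℝ Set.univ q) (hqdiff : HasFDerivAt q (dotCLM (g a)) a)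
    (hmin : Jmaj X y lam sigma q g a b + dotp d (b - a)
      ≤ Jmaj X y lam sigma q g a a + dotp d (a - a))
    (hd : euclNorm d ≤ (sigma / 4) * euclNorm (b - a)) :
    fObj X y lam q b + (sigma / 4) * euclNorm (b - a) ^ 2 ≤ fObj X y lam q a := by
  have htangent := hqconv.add_fderiv_sub_le hqdiff b
  rw [dotCLM_apply] at htangent
  have hcs := neg_mul_euclNorm_le_dotp d (b - a)
  have hstep := mul_le_mul_of_nonneg_right hd (euclNorm_nonneg (b - a))
  have hdot : ∀ v : Fin p → ℝ, dotp v (a - a) = 0 := fun v => by simp [dotp]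
  have hzero : euclNorm (a - a) = 0 := by simp [euclNorm]
  simp only [Jmaj, hdot, hzero] at hmin
  unfold fObj
  linarith

/-- along the PMM iterations with `inf_k σ^{2,k} > 0`, the sequence
`(f(β^k))` is non-increasing and convergent, and `‖β^{k+1} − β^k‖ → 0`. -/
theorem pmm_objective_convergence {n p : ℕ} (lam : ℝ) (hlam : 0 < lam)
    (X : Matrix (Fin n) (Fin p) ℝ) (y : Fin n → ℝ)
    (q : (Fin p → ℝ) → ℝ) (g : (Fin p → ℝ) → (Fin p → ℝ))
    (hqconv : ConvexOn ℝ Set.univ q)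
    (hqdiff : ∀ β : Fin p → ℝ, HasFDerivAt q (dotCLM (g β)) β)
    (hbdd : ∃ c : ℝ, ∀ β : Fin p → ℝ, c ≤ fObj X y lam q β)
    (σ2 : ℕ → ℝ) (hσ2 : ∀ k, 0 < σ2 k) (hσinf : 0 < ⨅ k, σ2 k)
    (β : ℕ → Fin p → ℝ) (δ : ℕ → Fin p → ℝ)
    (hmin : ∀ k, ∀ b : Fin p → ℝ,
      Jmaj X y lam (σ2 k) q g (β k) (β (k + 1)) + dotp (δ k) (β (k + 1) - β k)
        ≤ Jmaj X y lam (σ2 k) q g (β k) b + dotp (δ k) (b - β k))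
    (hδ : ∀ k, euclNorm (δ k) ≤ (σ2 k / 4) * euclNorm (β (k + 1) - β k)) :
    (∀ k, fObj X y lam q (β (k + 1)) ≤ fObj X y lam q (β k)) ∧
    (∃ L : ℝ, Tendsto (fun k => fObj X y lam q (β k)) atTop (nhds L)) ∧
    Tendsto (fun k => euclNorm (β (k + 1) - β k)) atTop (nhds 0) := by
  have hdesc k := fObj_add_sq_le hqconv (hqdiff (β k)) (hmin k (β k)) (hδ k)
  have hmono : ∀ k, fObj X y lam q (β (k + 1)) ≤ fObj X y lam q (β k) := fun k => by
    have := mul_nonneg (hσ2 k).le (sq_nonneg (euclNorm (β (k + 1) - β k)))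
    linarith [hdesc k]
  obtain ⟨c, hc⟩ := hbdd
  have hlim := tendsto_atTop_ciInf (antitone_nat_of_succ_le hmono)
    ⟨c, Set.forall_mem_range.2 fun k => hc (β k)⟩
  refine ⟨hmono, ⟨_, hlim⟩, ?_⟩
  set m := ⨅ k, σ2 k
  have hmle k : m ≤ σ2 k := ciInf_le ⟨0, Set.forall_mem_range.2 fun k => (hσ2 k).le⟩ k
  have hsq : Tendsto (fun k => euclNorm (β (k + 1) - β k) ^ 2) atTop (𝓝 0) := by
    have hdiff := (hlim.sub (hlim.comp (tendsto_add_atTop_nat 1))).const_mul (4 / m)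
    rw [sub_self, mul_zero] at hdiff
    refine squeeze_zero (fun k => sq_nonneg _) (fun k => ?_) hdiff
    have := mul_le_mul_of_nonneg_right (hmle k) (sq_nonneg (euclNorm (β (k + 1) - β k)))
    rw [div_mul_eq_mul_div, le_div_iff₀ hσinf]
    simp only [Function.comp_apply]
    linarith [hdesc k]
  simpa [Real.sqrt_sq (euclNorm_nonneg _)] using hsq.sqrt
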